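/- Let K be an algebraically closed field of characteristic zero and let n ≥ 2 be an integer. Set N = 2·n²·(n+1)·C(3n−1, n). Let F(t) = t^n + a_{n−1}·t^{n−1} + ⋯ + a_1·t + a_0 ∈ K(x)[t] be a monic polynomial of degree n with coefficients a_i ∈ K(x). If there are at least N values λ ∈ K for which F(λ) ∈ K(x) is nonzero and n-powerful, then either all the coefficients a_0, …, a_{n−1} lie in K, or there exists ν ∈ K(x) such that F(t) = (t + ν)^n in K(x)[t]. -/

import Mathlib

open Polynomial

/-- A nonzero rational function `f` is `n`-powerful if every root of its numerator
has multiplicity at least `n`, and moreover either `deg num ≥ deg denom` or the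
zero at infinity (of order `deg denom - deg num`) has multiplicity at least `n`. -/
def IsNPowerful {K : Type*} [Field K] (n : ℕ) (f : RatFunc K) : Prop :=
  (∀ a : K, f.num.eval a = 0 → n ≤ f.num.rootMultiplicity a) ∧
  (f.denom.natDegree ≤ f.num.natDegree ∨ f.num.natDegree + n ≤ f.denom.natDegree)

section Bivariate

variable {K : Type*} [Field K]

/-- The derivation of `K[X][X]` that differentiates every coefficient. -/
noncomputable def coeffDeriv : Derivation K K[X][X] K[X][X] :=
  PolynomialModule.equivPolynomialSelf.compDer derivative'.mapCoeffs

lemma coeff_coeffDeriv (P : K[X][X]) (i : ℕ) :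
    (coeffDeriv P).coeff i = derivative (P.coeff i) := rfl

lemma natDegree_coeffDeriv_le (P : K[X][X]) : (coeffDeriv P).natDegree ≤ P.natDegree := by
  refine natDegree_le_iff_coeff_eq_zero.2 fun i hi => ?_
  rw [coeff_coeffDeriv, coeff_eq_zero_of_natDegree_lt hi, derivative_zero]

lemma eval_C_coeffDeriv (P : K[X][X]) (c : K) :
    (coeffDeriv P).eval (C c) = derivative (P.eval (C c)) := by
  rw [eval_eq_sum_range' (Nat.lt_succ_of_le (natDegree_coeffDeriv_le P)), eval_eq_sum_range]
  simp [coeff_coeffDeriv, derivative_pow]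

lemma natDegree_resultant_le (P Q : K[X][X]) (m n d : ℕ)
    (hP : ∀ i, (P.coeff i).natDegree ≤ d) (hQ : ∀ i, (Q.coeff i).natDegree ≤ d) :
    (resultant P Q m n).natDegree ≤ (m + n) * d := by
  rw [resultant, Matrix.det_apply]
  refine natDegree_sum_le_of_forall_le _ _ fun σ _ => ?_
  refine (natDegree_smul_le _ _).trans ((natDegree_prod_le _ _).trans ?_)
  have h : ∀ i j, (sylvester P Q m n i j).natDegree ≤ d := by
    intro i j
    refine Fin.addCases (fun j => ?_) (fun j => ?_) j
    · simp only [sylvester, Matrix.of_apply, Fin.addCases_left]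
      split_ifs
      · exact hQ _
      · simp
    · simp only [sylvester, Matrix.of_apply, Fin.addCases_right]
      split_ifs
      · exact hP _
      · simp
  simpa using Finset.sum_le_card_nsmul Finset.univ _ d fun i _ => h (σ i) i

lemma resultant_ne_zero_of_isRelPrime {A : Type*} [CommRing A] [IsDomain A]
    [UniqueFactorizationMonoid A] {P Q : A[X]} (hP : P ≠ 0) (h : IsRelPrime P Q) :
    resultant P Q ≠ 0 := by
  intro h0
  obtain ⟨v, hv, hv0⟩ := Matrix.exists_mulVec_eq_zero_iff.2 h0
  let b₁ := ((degreeLT.basis A P.natDegree).prod (degreeLT.basis A Q.natDegree)).reindex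
    finSumFinEquiv
  let b₂ := degreeLT.basis A (P.natDegree + Q.natDegree)
  have hx : sylvesterMap P Q le_rfl le_rfl (b₁.equivFun.symm v) = 0 := by
    apply b₂.repr.injective
    apply DFunLike.coe_injective
    rw [← LinearMap.toMatrix_mulVec_repr b₁ b₂, toMatrix_sylvesterMap',
      ← Module.Basis.equivFun_apply, LinearEquiv.apply_symm_apply, hv0]
    simp
  have hx0 : b₁.equivFun.symm v ≠ 0 := (LinearEquiv.map_ne_zero_iff _).2 hv
  generalize b₁.equivFun.symm v = x at hx hx0
  obtain ⟨⟨p, hp⟩, ⟨q, hq⟩⟩ := x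
  have hpq : P * q + Q * p = 0 := congrArg Subtype.val hx
  have hdvd : P ∣ p := h.dvd_of_dvd_mul_left ⟨-q, by linear_combination hpq⟩
  rw [mem_degreeLT] at hp
  have hp0 : p = 0 := by
    by_contra hne
    have := degree_le_of_dvd hdvd hne
    rw [degree_eq_natDegree hP] at this
    exact absurd hp this.not_gt
  subst hp0
  have hq0 : q = 0 := by simpa [hP] using hpq
  subst hq0
  exact hx0 rfl

lemma isRelPrime_coeffDeriv [CharZero K] {P : K[X][X]} (hsq : Squarefree P)
    (hP : ∀ p, Irreducible p → p ∣ P → p ∉ Set.range (map (C : K →+* K[X]))) :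
    IsRelPrime P (coeffDeriv P) := by
  have hP0 : P ≠ 0 := hsq.ne_zero
  refine WfDvdMonoid.isRelPrime_of_no_irreducible_factors (by simp [hP0]) fun p hp hpP hpD => ?_
  refine hP p hp hpP ?_
  obtain ⟨S, rfl⟩ := hpP
  have hS : ¬ p ∣ S := fun ⟨T, hT⟩ => hp.not_isUnit (hsq p ⟨T, by rw [hT, mul_assoc]⟩)
  rw [Derivation.leibniz, smul_eq_mul, smul_eq_mul, dvd_add_right (dvd_mul_right _ _)] at hpD
  obtain ⟨c, hc⟩ := (hp.prime.dvd_or_dvd hpD).resolve_left hS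
  have hzero : coeffDeriv p = 0 := by
    by_contra hne
    have hc0 : c ≠ 0 := by rintro rfl; simp [hne] at hc
    have hdeg := natDegree_coeffDeriv_le p
    rw [hc, natDegree_mul hp.ne_zero hc0] at hdeg
    obtain ⟨r, rfl⟩ := natDegree_eq_zero.1 (show c.natDegree = 0 by lia)
    refine hne (Polynomial.ext fun i => ?_)
    have hi := coeff_coeffDeriv p i
    rw [hc, coeff_mul_C] at hi
    rw [coeff_coeffDeriv, coeff_zero]
    by_contra hd
    have hlt := degree_derivative_lt (p := p.coeff i) (by rintro h; simp [h] at hd)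
    exact absurd (degree_le_of_dvd ⟨r, hi.symm⟩ hd) hlt.not_ge
  refine ⟨p.map (evalRingHom 0), Polynomial.ext fun i => ?_⟩
  have hi : derivative (p.coeff i) = 0 := by rw [← coeff_coeffDeriv, hzero, coeff_zero]
  obtain ⟨r, hr⟩ := natDegree_eq_zero.1 (derivative_eq_zero.1 hi)
  simp [coeff_map, ← hr]

lemma exists_coeff_natDegree_eq (P : K[X][X]) (hP : P ∉ Set.range (map (C : K →+* K[X]))) :
    ∃ d, 0 < d ∧ (∀ i, (P.coeff i).natDegree ≤ d) ∧ ∃ i, (P.coeff i).natDegree = d := by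
  have hle : ∀ i, (P.coeff i).natDegree ≤ P.support.sup fun j => (P.coeff j).natDegree := by
    intro i
    by_cases hi : P.coeff i = 0
    · simp [hi]
    · exact Finset.le_sup (f := fun j => (P.coeff j).natDegree) (mem_support_iff.2 hi)
  have hpos : 0 < P.support.sup fun j => (P.coeff j).natDegree := by
    rw [Nat.pos_iff_ne_zero]
    intro h0
    refine hP ⟨P.map (evalRingHom 0), Polynomial.ext fun i => ?_⟩
    obtain ⟨r, hr⟩ := natDegree_eq_zero.1 (Nat.le_zero.1 (h0 ▸ hle i))
    simp [coeff_map, ← hr]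
  refine ⟨_, hpos, hle, ?_⟩
  have hne : P.support.Nonempty := by
    rw [Finset.nonempty_iff_ne_empty]
    rintro h
    simp [h] at hpos
  obtain ⟨i, -, hi⟩ := Finset.exists_mem_eq_sup _ hne fun j => (P.coeff j).natDegree
  exact ⟨i, hi.symm⟩

lemma natDegree_eval_C_le {P : K[X][X]} {d : ℕ} (hd : ∀ i, (P.coeff i).natDegree ≤ d) (c : K) :
    (P.eval (C c)).natDegree ≤ d := by
  rw [eval_eq_sum_range]
  refine natDegree_sum_le_of_forall_le _ _ fun i _ => ?_
  rw [← C_pow]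
  exact (natDegree_mul_C_le _ _).trans (hd i)

lemma card_filter_natDegree_eval_C_lt_le (P : K[X][X]) {d : ℕ} (hd0 : 0 < d)
    (hi : ∃ i, (P.coeff i).natDegree = d) (B : Finset K) :
    (B.filter fun c => (P.eval (C c)).natDegree < d).card ≤ P.natDegree := by
  obtain ⟨i, hi⟩ := hi
  let T : K[X] := ∑ j ∈ Finset.range (P.natDegree + 1), monomial j ((P.coeff j).coeff d)
  have hPi : P.coeff i ≠ 0 := by
    intro h
    rw [h, natDegree_zero] at hi
    lia
  have hT0 : T ≠ 0 := by
    intro h0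
    have hc : T.coeff i = (P.coeff i).coeff d := by
      simp only [T, finsetSum_coeff, coeff_monomial, Finset.sum_ite_eq', Finset.mem_range]
      rw [if_pos (Nat.lt_succ_of_le (le_natDegree_of_ne_zero hPi))]
    rw [h0, coeff_zero, ← hi, coeff_natDegree] at hc
    exact hPi (leadingCoeff_eq_zero.1 hc.symm)
  have hTdeg : T.natDegree ≤ P.natDegree :=
    natDegree_sum_le_of_forall_le _ _ fun j hj =>
      (natDegree_monomial_le _).trans (Nat.lt_succ_iff.1 (Finset.mem_range.1 hj))
  refine le_trans (card_le_degree_of_subset_roots (p := T) fun c hc => ?_) hTdeg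
  rw [mem_roots hT0, IsRoot]
  have hlt := (Finset.mem_filter.1 hc).2
  rw [← coeff_eq_zero_of_natDegree_lt hlt, eval_eq_sum_range (p := P)]
  simp only [T, eval_finsetSum, eval_monomial, finsetSum_coeff, ← C_pow, coeff_mul_C]

lemma card_filter_eval_eval_C_eq_zero_le [DecidableEq K] {P : K[X][X]} {x : K}
    (hx : P.map (evalRingHom x) ≠ 0) (B : Finset K) :
    (B.filter fun c => (P.eval (C c)).eval x = 0).card ≤ P.natDegree := by
  refine le_trans (card_le_degree_of_subset_roots (p := P.map (evalRingHom x)) fun c hc => ?_)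
    natDegree_map_le
  rw [mem_roots hx, IsRoot]
  have h := eval_map_apply (p := P) (evalRingHom x) (C c)
  simpa [(Finset.mem_filter.1 hc).2] using h

lemma map_evalRingHom_ne_zero {P : K[X][X]}
    (hP : ∀ p, Irreducible p → p ∣ P → p.natDegree ≠ 0) (x : K) :
    P.map (evalRingHom x) ≠ 0 := by
  intro h
  refine hP (C (X - C x)) ((prime_C_iff.2 (prime_X_sub_C x)).irreducible) ?_ (natDegree_C _)
  rw [C_dvd_iff_dvd_coeff]
  intro i
  rw [dvd_iff_isRoot, IsRoot, ← coe_evalRingHom, ← coeff_map, h, coeff_zero]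

lemma rootMultiplicity_sub_one_le_of_mul_add_mul_derivative_eq {f u v r : K[X]} (hr : r ≠ 0)
    (h : f * u + derivative f * v = r) (x : K) :
    f.rootMultiplicity x - 1 ≤ r.rootMultiplicity x := by
  rw [le_rootMultiplicity_iff hr, ← h]
  have hf := pow_rootMultiplicity_dvd f x
  exact dvd_add (dvd_mul_of_dvd_left ((pow_dvd_pow _ (Nat.sub_le _ _)).trans hf) _)
    (dvd_mul_of_dvd_left (pow_sub_one_dvd_derivative_of_pow_dvd hf) _)

/-- A squarefree polynomial in two variables, each of whose irreducible factors involves both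
variables, has few specializations `t = c` all of whose zeros away from the leading coefficient
are multiple. Such zeros are zeros of the resultant of `P` and `coeffDeriv P`, whose degree is
bounded linearly in the degree of `P` in the inner variable. -/
lemma card_le_of_sq_dvd_eval_C [IsAlgClosed K] [CharZero K] {P : K[X][X]} (hsq : Squarefree P)
    (hunit : ¬ IsUnit P)
    (hP : ∀ p, Irreducible p → p ∣ P →
      p.natDegree ≠ 0 ∧ p ∉ Set.range (map (C : K →+* K[X])))
    (B : Finset K)
    (hB : ∀ c ∈ B, ∀ x, P.leadingCoeff.eval x ≠ 0 → (P.eval (C c)).eval x = 0 →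
      (X - C x) ^ 2 ∣ P.eval (C c)) :
    B.card ≤ 4 * P.natDegree ^ 2 + 2 * P.natDegree := by
  have hP0 : P ≠ 0 := hsq.ne_zero
  have hlc : P.leadingCoeff ≠ 0 := leadingCoeff_ne_zero.2 hP0
  obtain ⟨p, hp, hpP⟩ := WfDvdMonoid.exists_irreducible_factor hunit hP0
  have hk : P.natDegree ≠ 0 := fun h => (hP p hp hpP).1 <|
    Nat.le_zero.1 (h ▸ natDegree_le_of_dvd hpP hP0)
  have hrange : P ∉ Set.range (map (C : K →+* K[X])) := by
    rintro ⟨f, rfl⟩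
    rw [natDegree_map] at hk
    obtain ⟨c, hc⟩ := IsAlgClosed.exists_root f fun h => hk (natDegree_eq_of_degree_eq_some h)
    have hdvd := map_dvd (mapRingHom (C : K →+* K[X])) (dvd_iff_isRoot.2 hc)
    refine (hP (X - C (C c)) (prime_X_sub_C _).irreducible (by simpa using hdvd)).2
      ⟨X - C c, by simp⟩
  obtain ⟨d, hd0, hd, hd'⟩ := exists_coeff_natDegree_eq P hrange
  set k := P.natDegree
  have hrel := isRelPrime_coeffDeriv hsq fun p hp hpP => (hP p hp hpP).2
  set ρ := resultant P (coeffDeriv P)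
  have hρ0 : ρ ≠ 0 := resultant_ne_zero_of_isRelPrime hP0 hrel
  have hρdeg : ρ.natDegree ≤ 2 * k * d := by
    refine (natDegree_resultant_le P (coeffDeriv P) _ _ d hd fun i => ?_).trans ?_
    · rw [coeff_coeffDeriv]
      exact (natDegree_derivative_le _).trans ((Nat.sub_le _ _).trans (hd i))
    · gcongr
      have := natDegree_coeffDeriv_le P
      lia
  obtain ⟨U, V, -, -, hUV⟩ :=
    exists_mul_add_mul_eq_C_resultant P (coeffDeriv P) le_rfl le_rfl (Or.inl hk)
  have hmult : ∀ c x, (P.eval (C c)).rootMultiplicity x - 1 ≤ ρ.rootMultiplicity x := by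
    intro c x
    refine rootMultiplicity_sub_one_le_of_mul_add_mul_derivative_eq (u := U.eval (C c))
      (v := V.eval (C c)) hρ0 ?_ x
    rw [← eval_C_coeffDeriv, ← eval_mul, ← eval_mul, ← eval_add, hUV, eval_C]
  set σ := ρ ^ 2 * P.leadingCoeff with hσ
  have hσ0 : σ ≠ 0 := mul_ne_zero (pow_ne_zero _ hρ0) hlc
  have hσdeg : σ.natDegree ≤ (4 * k + 1) * d := by
    have h1 : σ.natDegree ≤ 2 * ρ.natDegree + P.leadingCoeff.natDegree :=
      natDegree_mul_le.trans (Nat.add_le_add_right natDegree_pow_le _)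
    have h2 : P.leadingCoeff.natDegree ≤ d := hd _
    nlinarith
  set B' := B.filter fun c => ¬ (P.eval (C c)).natDegree < d
  have hBB' : B.card ≤ k + B'.card := by
    rw [← Finset.card_filter_add_card_filter_not (s := B)
      fun c => (P.eval (C c)).natDegree < d]
    exact Nat.add_le_add_right (card_filter_natDegree_eval_C_lt_le P hd0 hd' B) _
  have hdeg : ∀ c ∈ B', (P.eval (C c)).natDegree = d := fun c hc =>
    le_antisymm (natDegree_eval_C_le hd c) (not_lt.1 (Finset.mem_filter.1 hc).2)
  have hne : ∀ c ∈ B', P.eval (C c) ≠ 0 := by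
    intro c hc h
    have := hdeg c hc
    rw [h, natDegree_zero] at this
    lia
  have hle : ∀ c ∈ B', ∀ x, (P.eval (C c)).eval x = 0 →
      (P.eval (C c)).rootMultiplicity x ≤ σ.rootMultiplicity x := by
    intro c hc x hx
    have hm := hmult c x
    have hpos := (rootMultiplicity_pos (hne c hc)).2 hx
    rw [hσ, rootMultiplicity_mul hσ0, sq, rootMultiplicity_mul (mul_ne_zero hρ0 hρ0)]
    by_cases hx' : P.leadingCoeff.eval x = 0
    · have := (rootMultiplicity_pos hlc).2 hx'
      lia
    · have := (le_rootMultiplicity_iff (hne c hc)).2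
        (hB c (Finset.mem_filter.1 hc).1 x hx' hx)
      lia
  have hroots : (∏ c ∈ B', P.eval (C c)).roots ≤ k • σ.roots := by
    classical
    rw [Multiset.le_iff_count]
    intro x
    rw [roots_prod _ _ (Finset.prod_ne_zero_iff.2 hne), Multiset.count_bind, Multiset.count_nsmul]
    simp only [count_roots]
    change ∑ c ∈ B', (P.eval (C c)).rootMultiplicity x ≤ _
    rw [← Finset.sum_filter_of_ne (p := fun c => (P.eval (C c)).eval x = 0)
      (fun c hc h => (rootMultiplicity_pos (hne c hc)).1 (Nat.pos_of_ne_zero h))]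
    refine (Finset.sum_le_card_nsmul _ _ (σ.rootMultiplicity x) fun c hc => ?_).trans ?_
    · exact hle c (Finset.mem_filter.1 hc).1 x (Finset.mem_filter.1 hc).2
    · rw [smul_eq_mul]
      exact Nat.mul_le_mul_right _ <| card_filter_eval_eval_C_eq_zero_le
        (map_evalRingHom_ne_zero (fun p hp hpP => (hP p hp hpP).1) x) B'
  have hcard := Multiset.card_le_card hroots
  rw [Multiset.card_nsmul, ← (IsAlgClosed.splits _).natDegree_eq_card_roots,
    ← (IsAlgClosed.splits _).natDegree_eq_card_roots, natDegree_prod _ _ hne,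
    Finset.sum_congr rfl hdeg, Finset.sum_const, smul_eq_mul] at hcard
  have hfin : B'.card * d ≤ (k * (4 * k + 1)) * d :=
    hcard.trans (by rw [mul_assoc]; exact Nat.mul_le_mul_left _ hσdeg)
  have := Nat.le_of_mul_le_mul_right hfin hd0
  nlinarith

lemma dvd_radical_pow_of_forall_not_pow_dvd {M : Type*} [CommMonoidWithZero M]
    [NormalizationMonoid M] [UniqueFactorizationMonoid M] [Nontrivial M] {a : M} (ha : a ≠ 0)
    {m : ℕ} (h : ∀ p, Irreducible p → ¬ p ^ (m + 1) ∣ a) :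
    a ∣ UniqueFactorizationMonoid.radical a ^ m := by
  classical
  have hr : UniqueFactorizationMonoid.radical a ≠ 0 := UniqueFactorizationMonoid.radical_ne_zero
  rw [UniqueFactorizationMonoid.dvd_iff_normalizedFactors_le_normalizedFactors ha
    (pow_ne_zero _ hr), UniqueFactorizationMonoid.normalizedFactors_pow, Multiset.le_iff_count]
  intro p
  rw [Multiset.count_nsmul]
  by_cases hp : p ∈ UniqueFactorizationMonoid.normalizedFactors a
  · have hirr := UniqueFactorizationMonoid.irreducible_of_normalized_factor p hp
    have hmem : p ∈ UniqueFactorizationMonoid.normalizedFactors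
        (UniqueFactorizationMonoid.radical a) := by
      rw [← UniqueFactorizationMonoid.mem_primeFactors,
        UniqueFactorizationMonoid.primeFactors_radical, UniqueFactorizationMonoid.mem_primeFactors]
      exact hp
    have hle : (UniqueFactorizationMonoid.normalizedFactors a).count p ≤ m := by
      by_contra! hlt
      refine h p hirr ?_
      have hsub := Multiset.le_count_iff_replicate_le.1 (Nat.succ_le_of_lt hlt)
      have hdvd := Multiset.prod_dvd_prod_of_le hsub
      rw [Multiset.prod_replicate] at hdvd
      exact hdvd.trans (UniqueFactorizationMonoid.prod_normalizedFactors ha).dvd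
    calc _ ≤ m * 1 := by simpa using hle
      _ ≤ _ := Nat.mul_le_mul_left m (Multiset.one_le_count_iff_mem.2 hmem)
  · simp [Multiset.count_eq_zero_of_notMem hp]

/-- Separate the irreducible factors involving only one variable from the others. -/
lemma exists_eq_C_mul_map_C_mul {Q : K[X][X]} (hQ : Q ≠ 0) :
    ∃ (u w : K[X]) (M : K[X][X]), w.Monic ∧ Q = C u * w.map C * M ∧
      ∀ p, Irreducible p → p ∣ M →
        p.natDegree ≠ 0 ∧ p ∉ Set.range (map (C : K →+* K[X])) := by
  induction Q using WfDvdMonoid.induction_on_irreducible with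
  | zero => exact absurd rfl hQ
  | unit Q h =>
    exact ⟨1, 1, Q, monic_one, by simp,
      fun p hp hpQ => absurd (isUnit_of_dvd_unit hpQ h) hp.not_isUnit⟩
  | mul Q i hQ0 hi ih =>
    obtain ⟨u, w, M, hw, hfac, hM⟩ := ih hQ0
    by_cases hdeg : i.natDegree = 0
    · obtain ⟨v, rfl⟩ := natDegree_eq_zero.1 hdeg
      exact ⟨v * u, w, M, hw, by rw [hfac, C_mul]; ring, hM⟩
    by_cases hrange : i ∈ Set.range (map (C : K →+* K[X]))
    · obtain ⟨f, rfl⟩ := hrange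
      have hf : f ≠ 0 := by rintro rfl; simp at hdeg
      refine ⟨C f.leadingCoeff * u, f * C f.leadingCoeff⁻¹ * w, M,
        (monic_mul_leadingCoeff_inv hf).mul hw, ?_, hM⟩
      have h1 : (C (C f.leadingCoeff) * C (C f.leadingCoeff⁻¹) : K[X][X]) = 1 := by
        rw [← C_mul, ← C_mul, mul_inv_cancel₀ (leadingCoeff_ne_zero.2 hf), C_1, C_1]
      simp only [hfac, C_mul, Polynomial.map_mul, map_C]
      linear_combination (-(f.map C * C u * w.map C * M)) * h1
    · refine ⟨u, w, i * M, hw, by rw [hfac]; ring, fun p hp hpM => ?_⟩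
      rcases hp.prime.dvd_or_dvd hpM with hpi | hpM
      · obtain ⟨v, hv⟩ := hpi
        have hvu : IsUnit v := (hi.isUnit_or_isUnit hv).resolve_left hp.not_isUnit
        obtain ⟨r, hr, rfl⟩ := Polynomial.isUnit_iff.1 hvu
        obtain ⟨s, hs, rfl⟩ := Polynomial.isUnit_iff.1 hr
        constructor
        · intro h0
          rw [hv, natDegree_mul_C (by simpa using hs.ne_zero)] at hdeg
          exact hdeg h0
        · rintro ⟨f, rfl⟩
          exact hrange ⟨f * C s, by simp [hv]⟩
      · exact hM p hp hpM

lemma exists_map_mul_map_eq_C_mul {F : (RatFunc K)[X]} (hF : F.Monic) :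
    ∃ (w : K[X]) (M : K[X][X]), w.Monic ∧ M ≠ 0 ∧
      (∀ p, Irreducible p → p ∣ M →
        p.natDegree ≠ 0 ∧ p ∉ Set.range (map (C : K →+* K[X]))) ∧
      w.map RatFunc.C * M.map (algebraMap K[X] (RatFunc K)) =
        C (algebraMap K[X] (RatFunc K) M.leadingCoeff) * F := by
  have hinj := RatFunc.algebraMap_injective K
  obtain ⟨D, hD, hQ⟩ := IsLocalization.integerNormalization_spec (nonZeroDivisors K[X]) F
  set Q := IsLocalization.integerNormalization (nonZeroDivisors K[X]) F
  rw [Algebra.smul_def, Polynomial.algebraMap_apply] at hQ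
  have hD0 : D ≠ 0 := nonZeroDivisors.ne_zero hD
  have hQ0 : Q ≠ 0 := by
    intro h
    rw [h, Polynomial.map_zero, eq_comm, mul_eq_zero, C_eq_zero] at hQ
    exact hQ.elim (fun h => hD0 (hinj (h.trans (map_zero _).symm))) hF.ne_zero
  have hlc : Q.leadingCoeff = D := by
    apply hinj
    have := congrArg leadingCoeff hQ
    rwa [leadingCoeff_map_of_injective hinj, leadingCoeff_mul, leadingCoeff_C, hF.leadingCoeff,
      mul_one] at this
  obtain ⟨u, w, M, hw, hfac, hM⟩ := exists_eq_C_mul_map_C_mul hQ0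
  have hu : u ≠ 0 := by rintro rfl; simp [hfac] at hQ0
  refine ⟨w, M, hw, by rintro rfl; simp [hfac] at hQ0, hM, ?_⟩
  have hlc' : D = u * M.leadingCoeff := by
    rw [← hlc, hfac, leadingCoeff_mul, leadingCoeff_mul, leadingCoeff_C,
      (hw.map C).leadingCoeff, mul_one]
  have hwmap : (w.map C).map (algebraMap K[X] (RatFunc K)) = w.map RatFunc.C := by
    rw [Polynomial.map_map]
    rfl
  rw [hfac, hlc', Polynomial.map_mul, Polynomial.map_mul, map_C, hwmap, map_mul, C_mul,
    mul_assoc, mul_assoc] at hQ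
  exact mul_left_cancel₀ (C_ne_zero.2 fun h => hu (hinj (h.trans (map_zero _).symm))) hQ

lemma pow_dvd_eval_C_of_isNPowerful {F : (RatFunc K)[X]} {w : K[X]} {M : K[X][X]} (hM0 : M ≠ 0)
    (hF : w.map RatFunc.C * M.map (algebraMap K[X] (RatFunc K)) =
      C (algebraMap K[X] (RatFunc K) M.leadingCoeff) * F)
    {n : ℕ} {c : K} (hne : F.eval (RatFunc.C c) ≠ 0) (hpow : IsNPowerful n (F.eval (RatFunc.C c))) :
    M.eval (C c) ≠ 0 ∧ ∀ x, M.leadingCoeff.eval x ≠ 0 → (M.eval (C c)).eval x = 0 →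
      (X - C x) ^ n ∣ M.eval (C c) := by
  have hinj := RatFunc.algebraMap_injective K
  set f := F.eval (RatFunc.C c) with hf
  have heval : algebraMap K[X] (RatFunc K) (C (w.eval c) * M.eval (C c)) =
      algebraMap K[X] (RatFunc K) M.leadingCoeff * f := by
    have h := congrArg (eval (RatFunc.C c)) hF
    rw [eval_mul, eval_mul, eval_C, eval_map_apply] at h
    have h2 := eval_map_apply (p := M) (algebraMap K[X] (RatFunc K)) (C c)
    rw [RatFunc.algebraMap_C] at h2
    rw [map_mul, RatFunc.algebraMap_C, ← h2, h]
  have hprod : C (w.eval c) * M.eval (C c) ≠ 0 := by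
    intro h
    rw [h, map_zero, eq_comm, mul_eq_zero] at heval
    refine heval.elim (fun h => ?_) hne
    exact leadingCoeff_ne_zero.2 hM0 (hinj (h.trans (map_zero _).symm))
  have hw : w.eval c ≠ 0 := fun h => hprod (by rw [h, C_0, zero_mul])
  refine ⟨right_ne_zero_of_mul hprod, fun x hL hx => ?_⟩
  have hnd : C (w.eval c) * M.eval (C c) * f.denom = M.leadingCoeff * f.num := by
    apply hinj
    rw [map_mul, heval, map_mul, mul_assoc]
    congr 1
    nth_rewrite 1 [← RatFunc.num_div_denom f]
    exact div_mul_cancel₀ _ (RatFunc.algebraMap_ne_zero f.denom_ne_zero)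
  have hnum : f.num.eval x = 0 := by
    have h := congrArg (eval x) hnd
    simp only [eval_mul, hx, mul_zero, zero_mul] at h
    exact (mul_eq_zero.1 h.symm).resolve_left hL
  have hdvd : (X - C x) ^ n ∣ f.num :=
    (le_rootMultiplicity_iff (RatFunc.num_ne_zero hne)).1 (hpow.1 x hnum)
  have hcop : IsCoprime ((X - C x) ^ n) f.denom :=
    f.isCoprime_num_denom.of_isCoprime_of_dvd_left hdvd
  have h1 : (X - C x) ^ n ∣ C (w.eval c) * M.eval (C c) :=
    hcop.dvd_of_dvd_mul_right (hnd ▸ dvd_mul_of_dvd_right hdvd _)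
  exact (isUnit_C.2 hw.isUnit).dvd_mul_left.1 h1

lemma natDegree_add_natDegree_eq {F : (RatFunc K)[X]} {w : K[X]} {M : K[X][X]}
    (hw : w.Monic) (hM0 : M ≠ 0)
    (hF : w.map RatFunc.C * M.map (algebraMap K[X] (RatFunc K)) =
      C (algebraMap K[X] (RatFunc K) M.leadingCoeff) * F) :
    w.natDegree + M.natDegree = F.natDegree := by
  have hinj := RatFunc.algebraMap_injective K
  have hdeg := congrArg natDegree hF
  rwa [natDegree_C_mul (RatFunc.algebraMap_ne_zero (leadingCoeff_ne_zero.2 hM0)),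
    natDegree_mul (hw.map _).ne_zero ((Polynomial.map_ne_zero_iff hinj).2 hM0), natDegree_map,
    natDegree_map_eq_of_injective hinj] at hdeg

lemma eq_X_add_C_pow_of_pow_dvd {F : (RatFunc K)[X]} {w : K[X]} {M : K[X][X]}
    (hw : w.Monic) (hM0 : M ≠ 0)
    (hF : w.map RatFunc.C * M.map (algebraMap K[X] (RatFunc K)) =
      C (algebraMap K[X] (RatFunc K) M.leadingCoeff) * F)
    {p : K[X][X]} (hp : p.natDegree ≠ 0) (hdvd : p ^ F.natDegree ∣ M) (hF0 : F.natDegree ≠ 0) :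
    ∃ ν, F = (X + C ν) ^ F.natDegree := by
  obtain ⟨S, rfl⟩ := hdvd
  set n := F.natDegree with hn
  have hp0 : p ≠ 0 := by rintro rfl; simp at hp
  have hS0 : S ≠ 0 := right_ne_zero_of_mul hM0
  have hL := RatFunc.algebraMap_ne_zero (leadingCoeff_ne_zero.2 hM0)
  have hdeg := natDegree_add_natDegree_eq hw hM0 hF
  rw [natDegree_mul (pow_ne_zero _ hp0) hS0, natDegree_pow, ← hn] at hdeg
  have hnp : n ≤ n * p.natDegree := Nat.le_mul_of_pos_right _ (Nat.pos_of_ne_zero hp)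
  have hp1 : p.natDegree = 1 := by
    have : n * p.natDegree ≤ n * 1 := by lia
    have := Nat.le_of_mul_le_mul_left this (Nat.pos_of_ne_zero hF0)
    lia
  have hw1 : w = 1 := eq_one_of_monic_natDegree_zero hw (by lia)
  obtain ⟨s, rfl⟩ := natDegree_eq_zero.1 (show S.natDegree = 0 by lia)
  obtain ⟨a, ha, b, rfl⟩ := natDegree_eq_one.1 hp1
  have ha' := RatFunc.algebraMap_ne_zero ha
  refine ⟨algebraMap K[X] (RatFunc K) b / algebraMap K[X] (RatFunc K) a,
    mul_left_cancel₀ (C_ne_zero.2 hL) ?_⟩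
  rw [← hF, hw1, leadingCoeff_mul, leadingCoeff_pow, leadingCoeff_linear ha, leadingCoeff_C]
  simp only [Polynomial.map_one, one_mul, Polynomial.map_mul, Polynomial.map_pow,
    Polynomial.map_add, map_C, map_X, map_mul, map_pow]
  have hlin : (C (algebraMap K[X] (RatFunc K) a) * X + C (algebraMap K[X] (RatFunc K) b)) =
      C (algebraMap K[X] (RatFunc K) a) *
        (X + C (algebraMap K[X] (RatFunc K) b / algebraMap K[X] (RatFunc K) a)) := by
    rw [mul_add, ← C_mul, mul_div_cancel₀ _ ha']
  rw [hlin, mul_pow]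
  ring

theorem constant_or_eq_X_add_C_pow_of_isNPowerful [IsAlgClosed K] [CharZero K]
    {F : (RatFunc K)[X]} (hFm : F.Monic) (hF0 : F.natDegree ≠ 0) (B : Finset K)
    (hB : 4 * F.natDegree ^ 2 + 2 * F.natDegree < B.card)
    (hpow : ∀ c ∈ B, F.eval (RatFunc.C c) ≠ 0 ∧
      IsNPowerful F.natDegree (F.eval (RatFunc.C c))) :
    (∃ w : K[X], F = w.map RatFunc.C) ∨ ∃ ν, F = (X + C ν) ^ F.natDegree := by
  obtain ⟨w, M, hw, hM0, hM, hF⟩ := exists_map_mul_map_eq_C_mul hFm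
  have hL := RatFunc.algebraMap_ne_zero (leadingCoeff_ne_zero.2 hM0)
  by_cases hunit : IsUnit M
  · left
    obtain ⟨r, -, rfl⟩ := Polynomial.isUnit_iff.1 hunit
    refine ⟨w, mul_left_cancel₀ (C_ne_zero.2 hL) ?_⟩
    rw [← hF, leadingCoeff_C, map_C, mul_comm]
  right
  by_cases hpn : ∃ p, Irreducible p ∧ p ^ F.natDegree ∣ M
  · obtain ⟨p, hp, hdvd⟩ := hpn
    exact eq_X_add_C_pow_of_pow_dvd hw hM0 hF
      (hM p hp ((dvd_pow_self p hF0).trans hdvd)).1 hdvd hF0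
  push Not at hpn
  exfalso
  obtain ⟨m, hm⟩ := Nat.exists_eq_succ_of_ne_zero hF0
  let _ : StrongNormalizationMonoid K[X][X] :=
    UniqueFactorizationMonoid.strongNormalizationMonoid
  set R := UniqueFactorizationMonoid.radical M
  have hRM : R ∣ M := UniqueFactorizationMonoid.radical_dvd_self
  have hMR : M ∣ R ^ m := dvd_radical_pow_of_forall_not_pow_dvd hM0 (by rwa [hm] at hpn)
  have hRdeg : R.natDegree ≤ F.natDegree := by
    have h1 := natDegree_le_of_dvd hRM hM0
    have h2 := natDegree_add_natDegree_eq hw hM0 hF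
    lia
  have hcard := card_le_of_sq_dvd_eval_C (P := R) UniqueFactorizationMonoid.squarefree_radical
    (fun h => hunit (isUnit_of_dvd_unit hMR (h.pow m)))
    (fun p hp hpR => hM p hp (hpR.trans hRM)) B fun c hc x hlc hx => ?_
  · have := Nat.mul_le_mul hRdeg hRdeg
    nlinarith
  obtain ⟨hMc, hdvd⟩ := pow_dvd_eval_C_of_isNPowerful hM0 hF (hpow c hc).1 (hpow c hc).2
  have hRMc : R.eval (C c) ∣ M.eval (C c) := eval_dvd hRM
  have hRc : R.eval (C c) ≠ 0 := ne_zero_of_dvd_ne_zero hMc hRMc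
  have hlcM : M.leadingCoeff.eval x ≠ 0 := by
    intro h0
    have h := eval_dvd (x := x) (leadingCoeff_dvd_leadingCoeff hMR)
    rw [h0, zero_dvd_iff, leadingCoeff_pow, eval_pow] at h
    exact hlc (eq_zero_of_pow_eq_zero h)
  have hx' : (M.eval (C c)).eval x = 0 := zero_dvd_iff.1 (hx ▸ eval_dvd hRMc)
  have hpow' : (X - C x) ^ F.natDegree ∣ R.eval (C c) ^ m := by
    have h := eval_dvd (x := C c) hMR
    rw [eval_pow] at h
    exact (hdvd x hlcM hx').trans h
  classical
  rw [← le_rootMultiplicity_iff (pow_ne_zero _ hRc), ← count_roots,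
    roots_pow, Multiset.count_nsmul, count_roots, hm] at hpow'
  rw [← le_rootMultiplicity_iff hRc]
  by_contra! hlt
  have : m * rootMultiplicity x (R.eval (C c)) ≤ m * 1 := Nat.mul_le_mul_left m (by lia)
  lia

end Bivariate

theorem buchi_theorem_for_rational_functions
    {K : Type*} [Field K] [IsAlgClosed K] [CharZero K]
    (n : ℕ) (hn : 2 ≤ n)
    (a : Fin n → RatFunc K)
    (B : Finset K)
    (hB : 2 * n ^ 2 * (n + 1) * Nat.choose (3 * n - 1) n ≤ B.card)
    (hpow : ∀ lam ∈ B,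
      Polynomial.eval (RatFunc.C lam)
          (X ^ n + ∑ i : Fin n, C (a i) * X ^ (i : ℕ) : Polynomial (RatFunc K)) ≠ 0 ∧
      IsNPowerful n (Polynomial.eval (RatFunc.C lam)
          (X ^ n + ∑ i : Fin n, C (a i) * X ^ (i : ℕ) : Polynomial (RatFunc K)))) :
    (∀ i, ∃ k : K, a i = RatFunc.C k) ∨
    ∃ ν : RatFunc K,
      (X ^ n + ∑ i : Fin n, C (a i) * X ^ (i : ℕ) : Polynomial (RatFunc K))
        = (X + C ν) ^ n := by
  set F : (RatFunc K)[X] := X ^ n + ∑ i : Fin n, C (a i) * X ^ (i : ℕ) with hF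
  have hdeg : (∑ i : Fin n, C (a i) * X ^ (i : ℕ) : (RatFunc K)[X]).degree < n :=
    degree_sum_fin_lt a
  have hFm : F.Monic := monic_X_pow_add hdeg
  have hFn : F.natDegree = n := by
    refine natDegree_eq_of_degree_eq_some ?_
    rw [hF, degree_add_eq_left_of_degree_lt (by rwa [degree_X_pow]), degree_X_pow]
  have hcoeff : ∀ i : Fin n, F.coeff i = a i := by
    intro i
    simp [hF, coeff_X_pow, finsetSum_coeff, Fin.val_inj, i.2.ne]
  have hcard : 4 * n ^ 2 + 2 * n < B.card := by
    have hchoose : 1 ≤ (3 * n - 1).choose n := Nat.choose_pos (by lia)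
    have hle := (Nat.mul_le_mul_left (2 * n ^ 2 * (n + 1)) hchoose).trans hB
    nlinarith [Nat.mul_le_mul_left (n ^ 2) hn]
  rcases constant_or_eq_X_add_C_pow_of_isNPowerful hFm (by lia) B (by rwa [hFn])
    (by rwa [hFn]) with ⟨w, hw⟩ | h
  · exact Or.inl fun i => ⟨w.coeff i, by rw [← hcoeff i, hw, coeff_map]⟩
  · exact Or.inr (hFn ▸ h)
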